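/- Let G be a loopless finite graph with n vertices, c components, and b blocks that are not isolated vertices. Then for every real t with 1 < t ≤ 32/27, the chromatic polynomial P(G,t) is non-zero and has sign (−1)^{n+c+b}. -/

import Mathlib

open Polynomial

/-- A finite multigraph (loops and multiple edges allowed), given with a fixed
orientation of its edges: each edge `e` has a source `src e` and target `tgt e`. -/
structure Multigraph where
  V : Type
  E : Type
  [fintypeV : Fintype V]
  [fintypeE : Fintype E]
  [decEqV : DecidableEq V]
  [decEqE : DecidableEq E]
  src : E → V
  tgt : E → V

attribute [instance] Multigraph.fintypeV Multigraph.fintypeE Multigraph.decEqV Multigraph.decEqE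

namespace Multigraph

/-- The number of proper `t`-colourings of `G`. -/
noncomputable def properColorings (G : Multigraph) (t : ℕ) : ℕ :=
  Nat.card {f : G.V → Fin t // ∀ e : G.E, f (G.src e) ≠ f (G.tgt e)}

/-- `P` is the chromatic polynomial of `G`: its value at each positive integer `t`
is the number of proper `t`-colourings of `G`. -/
def IsChromaticPoly (G : Multigraph) (P : Polynomial ℝ) : Prop :=
  ∀ t : ℕ, 0 < t → P.eval (t : ℝ) = G.properColorings t

/-- `G` has no loops. -/
def Loopless (G : Multigraph) : Prop := ∀ e : G.E, G.src e ≠ G.tgt e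

/-- Deletion of the edge `e₀`. -/
def deleteEdge (G : Multigraph) (e₀ : G.E) : Multigraph where
  V := G.V
  E := {e : G.E // e ≠ e₀}
  src e := G.src e.1
  tgt e := G.tgt e.1

/-- Contraction of the edge `e₀`: its two endpoints are identified (the vertex
`src e₀` is merged into `tgt e₀`), and `e₀` is removed. -/
def contractEdge (G : Multigraph) (e₀ : G.E) : Multigraph where
  V := {v : G.V // v = G.src e₀ → v = G.tgt e₀}
  E := {e : G.E // e ≠ e₀}
  src e := if h : G.src e.1 = G.src e₀ then ⟨G.tgt e₀, fun _ => rfl⟩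
    else ⟨G.src e.1, fun hv => absurd hv h⟩
  tgt e := if h : G.tgt e.1 = G.src e₀ then ⟨G.tgt e₀, fun _ => rfl⟩
    else ⟨G.tgt e.1, fun hv => absurd hv h⟩

/-- Two vertices are connected by a walk using only edges in `A`. -/
def ReachOn (G : Multigraph) (A : Finset G.E) (a b : G.V) : Prop :=
  Relation.EqvGen (fun x y => ∃ e ∈ A, G.src e = x ∧ G.tgt e = y) a b

/-- The number of connected components of the spanning subgraph of `G`
with edge set `A`. -/
noncomputable def numComponentsOn (G : Multigraph) (A : Finset G.E) : ℕ :=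
  Nat.card (Quotient (Relation.EqvGen.setoid (fun x y => ∃ e ∈ A, G.src e = x ∧ G.tgt e = y)))

/-- The number of connected components of `G`. -/
noncomputable def numComponents (G : Multigraph) : ℕ := G.numComponentsOn Finset.univ

/-- `G` is connected. -/
def Conn (G : Multigraph) : Prop :=
  Nonempty G.V ∧ ∀ a b : G.V, G.ReachOn Finset.univ a b

/-- `e` is a bridge of `G`. -/
def IsBridge (G : Multigraph) (e : G.E) : Prop :=
  G.numComponents < (G.deleteEdge e).numComponents

/-- A nowhere-zero `ZMod t`-flow on `G` (with respect to the fixed orientation). -/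
def IsNZFlow (G : Multigraph) {t : ℕ} (f : G.E → ZMod t) : Prop :=
  (∀ e : G.E, f e ≠ 0) ∧
    ∀ v : G.V, (∑ e : G.E, if G.src e = v then f e else 0) =
      ∑ e : G.E, if G.tgt e = v then f e else 0

/-- The number of nowhere-zero `ZMod t`-flows of `G`. -/
noncomputable def numFlows (G : Multigraph) (t : ℕ) : ℕ :=
  Nat.card {f : G.E → ZMod t // G.IsNZFlow f}

/-- `F` is the flow polynomial of `G`: its value at each positive integer `t`
is the number of nowhere-zero `ZMod t`-flows of `G`. -/
def IsFlowPoly (G : Multigraph) (F : Polynomial ℝ) : Prop :=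
  ∀ t : ℕ, 0 < t → F.eval (t : ℝ) = G.numFlows t

end Multigraph

namespace Multigraph

variable {G : Multigraph}

/-- A subgraph of a multigraph: a set of vertices and a set of edges whose
endpoints lie among those vertices. -/
structure Subgr (G : Multigraph) where
  verts : Set G.V
  edges : Set G.E
  src_mem : ∀ e ∈ edges, G.src e ∈ verts
  tgt_mem : ∀ e ∈ edges, G.tgt e ∈ verts

/-- Reachability inside a subgraph (using only its edges). -/
def Subgr.ReachIn (H : Subgr G) (a b : G.V) : Prop :=
  Relation.EqvGen (fun x y => ∃ e ∈ H.edges, G.src e = x ∧ G.tgt e = y) a b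

/-- A subgraph is connected if it is nonempty and any two of its vertices are
joined by a walk inside it. -/
def Subgr.ConnIn (H : Subgr G) : Prop :=
  H.verts.Nonempty ∧ ∀ a ∈ H.verts, ∀ b ∈ H.verts, H.ReachIn a b

/-- Deleting a vertex from a subgraph (together with all incident edges). -/
def Subgr.deleteVert (H : Subgr G) (v : G.V) : Subgr G where
  verts := H.verts \ {v}
  edges := {e ∈ H.edges | G.src e ≠ v ∧ G.tgt e ≠ v}
  src_mem := fun e he => ⟨H.src_mem e he.1, he.2.1⟩
  tgt_mem := fun e he => ⟨H.tgt_mem e he.1, he.2.2⟩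

/-- A subgraph `H` is non-separable if it is connected and `H - v` is connected
(or empty) for every vertex `v` of `H`. -/
def Subgr.Nonseparable (H : Subgr G) : Prop :=
  H.ConnIn ∧ ∀ v ∈ H.verts, (H.deleteVert v).verts = ∅ ∨ (H.deleteVert v).ConnIn

/-- A block of `G` is a maximal non-separable subgraph. -/
def Subgr.IsBlock (H : Subgr G) : Prop :=
  H.Nonseparable ∧ ∀ K : Subgr G, K.Nonseparable → H.verts ⊆ K.verts →
    H.edges ⊆ K.edges → (K.verts = H.verts ∧ K.edges = H.edges)

/-- The number of blocks of `G` which are not isolated vertices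
(i.e. which contain at least one edge). -/
noncomputable def numEdgeBlocks (G : Multigraph) : ℕ :=
  Nat.card {H : Subgr G // H.IsBlock ∧ H.edges.Nonempty}

end Multigraph

namespace ChromaticSign

variable {α : Type*} [DecidableEq α]

/-- The rank functions of matroids, on finite sets. -/
structure IsRank (r : Finset α → ℤ) : Prop where
  empty : r ∅ = 0
  mono : ∀ A B, A ⊆ B → r A ≤ r B
  submod : ∀ A B, r (A ∪ B) + r (A ∩ B) ≤ r A + r B
  singleton_le : ∀ e, r {e} ≤ 1

/-- The restriction to `S` of the matroid with rank function `r` is connected. -/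
def RankConn (r : Finset α → ℤ) (S : Finset α) : Prop :=
  ∀ X Y, Disjoint X Y → X ∪ Y = S → X.Nonempty → Y.Nonempty → r S < r X + r Y

/-- The rank function of the contraction of `f`. -/
def contract (r : Finset α → ℤ) (f : α) (A : Finset α) : ℤ := r (insert f A) - r {f}

/-- The multivariate Tutte polynomial of the restriction to `S`, normalised to have
constant term one. -/
noncomputable def tutte (r : Finset α → ℤ) (S : Finset α) (q : ℝ) (v : α → ℝ) : ℝ :=
  ∑ A ∈ S.powerset, q ^ (-r A) * ∏ e ∈ A, v e

namespace IsRank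

variable {r : Finset α → ℤ} (hr : IsRank r)
include hr

theorem nonneg (A : Finset α) : 0 ≤ r A := hr.empty ▸ hr.mono ∅ A (by simp)

theorem union_le (A B : Finset α) : r (A ∪ B) ≤ r A + r B := by
  have := hr.submod A B
  have := hr.nonneg (A ∩ B)
  omega

theorem insert_le (e : α) (A : Finset α) : r (insert e A) ≤ r A + 1 := by
  have := hr.union_le {e} A
  have := hr.singleton_le e
  rw [Finset.insert_eq]
  omega

/-- Marginal ranks decrease. -/
theorem marginal_anti {A B : Finset α} (h : A ⊆ B) {e : α} (he : e ∉ B) :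
    r (insert e B) + r A ≤ r B + r (insert e A) := by
  have := hr.submod B (insert e A)
  rwa [show B ∪ insert e A = insert e B by grind, show B ∩ insert e A = A by grind] at this

theorem contract (f : α) : IsRank (contract r f) where
  empty := by simp [ChromaticSign.contract]
  mono A B h := by
    have := hr.mono _ _ (Finset.insert_subset_insert f h)
    simp only [ChromaticSign.contract]; omega
  submod A B := by
    have := hr.submod (insert f A) (insert f B)
    rw [← Finset.insert_union_distrib, ← Finset.insert_inter_distrib] at this
    simp only [ChromaticSign.contract]; omega
  singleton_le e := by
    have := hr.insert_le e {f}
    rw [Finset.pair_comm] at this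
    simp only [ChromaticSign.contract]; omega

end IsRank

/-- If every element `e` of `S` splits some partition of `S \ {e}` in which all four sides
have connectivity at most one, then some pair of elements has connectivity at most one. -/
theorem exists_pair_le_one {S : Finset α} {l : Finset α → ℤ}
    (submod : ∀ A ⊆ S, ∀ B ⊆ S, l (A ∪ B) + l (A ∩ B) ≤ l A + l B)
    (pos : ∀ A ⊆ S, A.Nonempty → A ≠ S → 1 ≤ l A)
    (split : ∀ e ∈ S, ∃ X Y, X.Nonempty ∧ Y.Nonempty ∧ Disjoint X Y ∧ X ∪ Y = S.erase e ∧
      l X ≤ 1 ∧ l Y ≤ 1 ∧ l (insert e X) ≤ 1 ∧ l (insert e Y) ≤ 1)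
    (hS : S.Nonempty) :
    ∃ e f, e ≠ f ∧ {e, f} ⊆ S ∧ {e, f} ≠ S ∧ l {e, f} ≤ 1 := by
  obtain ⟨Z, hZ, hmin⟩ := Finset.exists_min_image
    (S.powerset.filter fun Z => 2 ≤ Z.card ∧ Z ≠ S ∧ l Z ≤ 1) Finset.card (by
      obtain ⟨e, he⟩ := hS
      obtain ⟨X, Y, hX, ⟨y, hy⟩, hd, hu, -, -, hl, -⟩ := split e he
      have heX : e ∉ X := fun h => by
        have : e ∈ S.erase e := hu ▸ Finset.mem_union_left Y h
        simp at this
      have hyS : y ∈ S.erase e := hu ▸ Finset.mem_union_right X hy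
      have hXS : X ⊆ S.erase e := hu ▸ Finset.subset_union_left
      refine ⟨insert e X, ?_⟩
      rw [Finset.mem_filter, Finset.mem_powerset]
      refine ⟨by grind, ?_, fun h => ?_, hl⟩
      · rw [Finset.card_insert_of_notMem heX]
        have := hX.card_pos
        omega
      · have hyX : y ∉ X := Finset.disjoint_right.1 hd hy
        rw [← h] at hyS
        grind)
  rw [Finset.mem_filter, Finset.mem_powerset] at hZ
  obtain ⟨hZS, hZ2, hZne, hlZ⟩ := hZ
  have hsub : ∀ W ⊂ Z, 2 ≤ W.card → ¬ l W ≤ 1 := fun W hW h2 hl => by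
    have h1 := Finset.card_lt_card hW
    have h3 := hmin W (by
      rw [Finset.mem_filter, Finset.mem_powerset]
      exact ⟨hW.1.trans hZS, h2, fun h => hW.2 (h ▸ hZS), hl⟩)
    omega
  by_cases hc : Z.card = 2
  · obtain ⟨e, f, hef, rfl⟩ := Finset.card_eq_two.1 hc
    exact ⟨e, f, hef, hZS, hZne, hlZ⟩
  obtain ⟨e, heZ⟩ : Z.Nonempty := Finset.card_pos.1 (by omega)
  have hce := Finset.card_erase_of_mem heZ
  have herase : ¬ l (Z.erase e) ≤ 1 := hsub _ (Finset.erase_ssubset heZ) (by omega)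
  exfalso
  have inside : ∀ X, X.Nonempty → e ∉ X → X ⊆ Z → l X ≤ 1 → l (insert e X) ≤ 1 → False := by
    intro X hX heX hXZ h1 h2
    have hcX := hX.card_pos
    by_cases hEq : insert e X = Z
    · exact herase (by rwa [← hEq, Finset.erase_insert heX])
    · refine hsub _ ((Finset.insert_subset heZ hXZ).ssubset_of_ne hEq) ?_ h2
      rw [Finset.card_insert_of_notMem heX]; omega
  obtain ⟨X, Y, hX, hY, hd, hu, hlX, hlY, hlX', hlY'⟩ := split e (hZS heZ)
  have hmem : ∀ a, a ∈ X ∨ a ∈ Y ↔ a ≠ e ∧ a ∈ S := fun a => by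
    rw [← Finset.mem_union, hu, Finset.mem_erase]
  have hdis : ∀ a, a ∈ X → a ∉ Y := fun a h => Finset.disjoint_left.1 hd h
  have heX : e ∉ X := fun h => ((hmem e).1 (Or.inl h)).1 rfl
  have heY : e ∉ Y := fun h => ((hmem e).1 (Or.inr h)).1 rfl
  have hXS : X ⊆ S := fun a h => ((hmem a).1 (Or.inl h)).2
  have hYS : Y ⊆ S := fun a h => ((hmem a).1 (Or.inr h)).2
  have uncross : ∀ W ⊆ S, l W ≤ 1 → Z ∪ W ≠ S → l (Z ∩ W) ≤ 1 := by
    intro W hW hl hne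
    have h1 := submod Z hZS W hW
    have h2 := pos (Z ∪ W) (Finset.union_subset hZS hW) ⟨e, Finset.mem_union_left _ heZ⟩ hne
    omega
  have meets : ∀ X Y, Y ⊆ S → (∀ a, a ∈ X ∨ a ∈ Y ↔ a ≠ e ∧ a ∈ S) → (∀ a, a ∈ X → a ∉ Y) →
      X ⊆ S → ¬ Y ⊆ Z → l X ≤ 1 → l (insert e X) ≤ 1 → Z ∩ X = ∅ := by
    intro X Y hYS hmem hdis hXS hYZ h1 h2
    obtain ⟨y, hy, hyZ⟩ := Finset.not_subset.1 hYZ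
    have heX : e ∉ X := fun h => ((hmem e).1 (Or.inl h)).1 rfl
    have hye : y ≠ e := by rintro rfl; exact hyZ heZ
    have hyX : y ∉ X := fun h => hdis y h hy
    have hne : ∀ W, y ∉ W → Z ∪ W ≠ S := fun W hW h => by
      have : y ∈ Z ∪ W := h ▸ hYS hy
      grind
    have h3 := uncross X hXS h1 (hne X hyX)
    have h4 := uncross (insert e X) (Finset.insert_subset (hZS heZ) hXS) h2
      (hne _ (by simp [hye, hyX]))
    by_contra hne'
    obtain ⟨x, hx⟩ := Finset.nonempty_iff_ne_empty.2 hne'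
    rw [Finset.mem_inter] at hx
    by_cases hEq : Z ∩ insert e X = Z
    · refine herase ?_
      rwa [show Z.erase e = Z ∩ X by
        ext a; have := Finset.ext_iff.1 hEq a; grind]
    · refine hsub _ (Finset.inter_subset_left.ssubset_of_ne hEq) ?_ h4
      have : ({e, x} : Finset α) ⊆ Z ∩ insert e X :=
        Finset.insert_subset (by simp [heZ]) (by simp [hx.1, hx.2])
      calc 2 = ({e, x} : Finset α).card := by
            rw [Finset.card_pair]; rintro rfl; exact heX hx.2
        _ ≤ _ := Finset.card_le_card this
  have hXZ := meets X Y hYS hmem hdis hXS (fun h => inside Y hY heY h hlY hlY') hlX hlX'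
  have hYZ := meets Y X hXS (fun a => or_comm.trans (hmem a)) (fun a h h' => hdis a h' h) hYS
    (fun h => inside X hX heX h hlX hlX') hlY hlY'
  obtain ⟨z, hz⟩ : (Z.erase e).Nonempty := Finset.card_pos.1 (by omega)
  have hz' := Finset.mem_erase.1 hz
  rcases (hmem z).2 ⟨hz'.1, hZS hz'.2⟩ with h | h
  · exact Finset.notMem_empty z (hXZ ▸ Finset.mem_inter.2 ⟨hz'.2, h⟩)
  · exact Finset.notMem_empty z (hYZ ▸ Finset.mem_inter.2 ⟨hz'.2, h⟩)

/-- A connected matroid on at least three elements has an element whose deletion and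
contraction are both connected, or else a parallel pair or a series pair. -/
theorem RankConn.exists_reduction {r : Finset α → ℤ} (hr : IsRank r) {S : Finset α}
    (hS : RankConn r S) (hne : S.Nonempty) :
    (∃ e ∈ S, RankConn r (S.erase e) ∧ RankConn (contract r e) (S.erase e)) ∨
    ∃ e f, e ≠ f ∧ {e, f} ⊆ S ∧ {e, f} ≠ S ∧ r {e, f} + r (S \ {e, f}) ≤ r S + 1 := by
  by_cases hex : ∃ e ∈ S, RankConn r (S.erase e) ∧ RankConn (contract r e) (S.erase e)
  · exact Or.inl hex
  right
  refine Exists.imp (fun e => Exists.imp fun f => ?_) (exists_pair_le_one (S := S)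
    (l := fun A => r A + r (S \ A) - r S) ?_ ?_ ?_ hne)
  · rintro ⟨h1, h2, h3, h4⟩
    exact ⟨h1, h2, h3, by simpa [sub_le_iff_le_add, add_comm] using h4⟩
  · intro A hA B hB
    have h1 := hr.submod A B
    have h2 := hr.submod (S \ A) (S \ B)
    rw [show S \ A ∪ S \ B = S \ (A ∩ B) by grind, show S \ A ∩ (S \ B) = S \ (A ∪ B) by grind]
      at h2
    omega
  · intro A hA hA' hAS
    have := hS A (S \ A) Finset.disjoint_sdiff (by grind) hA'
      (Finset.sdiff_nonempty.2 fun h => hAS (hA.antisymm h))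
    omega
  · intro e he
    have key : ∀ X Y, X.Nonempty → Y.Nonempty → Disjoint X Y → X ∪ Y = S.erase e →
        r X + r (insert e Y) ≤ r S + 1 → r Y + r (insert e X) ≤ r S + 1 →
        ∃ X Y, X.Nonempty ∧ Y.Nonempty ∧ Disjoint X Y ∧ X ∪ Y = S.erase e ∧
          r X + r (S \ X) - r S ≤ 1 ∧ r Y + r (S \ Y) - r S ≤ 1 ∧
          r (insert e X) + r (S \ insert e X) - r S ≤ 1 ∧
          r (insert e Y) + r (S \ insert e Y) - r S ≤ 1 := by
      intro X Y hX hY hd hu h1 h2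
      have hmem : ∀ a, a ∈ X ∨ a ∈ Y ↔ a ≠ e ∧ a ∈ S := fun a => by
        rw [← Finset.mem_union, hu, Finset.mem_erase]
      have hdis : ∀ a, a ∈ X → a ∉ Y := fun a h => Finset.disjoint_left.1 hd h
      have e1 : S \ X = insert e Y := by ext a; have := hmem a; have := hdis a; grind
      have e2 : S \ Y = insert e X := by ext a; have := hmem a; have := hdis a; grind
      have e3 : S \ insert e X = Y := by ext a; have := hmem a; have := hdis a; grind
      have e4 : S \ insert e Y = X := by ext a; have := hmem a; have := hdis a; grind
      refine ⟨X, Y, hX, hY, hd, hu, ?_, ?_, ?_, ?_⟩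
      · rw [e1]; omega
      · rw [e2]; omega
      · rw [e3]; omega
      · rw [e4]; omega
    have hins : ∀ X Y : Finset α, X ∪ Y = S.erase e → insert e X ∪ Y = S := fun X Y h => by
      rw [Finset.insert_union, h, Finset.insert_erase he]
    by_cases hdel : RankConn r (S.erase e)
    · have hcon : ¬ RankConn (contract r e) (S.erase e) := fun h => hex ⟨e, he, hdel, h⟩
      simp only [RankConn, not_forall, not_lt, contract, Finset.insert_erase he] at hcon
      obtain ⟨X, Y, hd, hu, hX, hY, h⟩ := hcon
      have h1 := hr.singleton_le e
      have h2 := hr.mono X (insert e X) (Finset.subset_insert _ _)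
      have h3 := hr.mono Y (insert e Y) (Finset.subset_insert _ _)
      exact key X Y hX hY hd hu (by omega) (by omega)
    · simp only [RankConn, not_forall, not_lt] at hdel
      obtain ⟨X, Y, hd, hu, hX, hY, h⟩ := hdel
      have h1 := hr.mono (S.erase e) S (Finset.erase_subset _ _)
      have h2 := hr.insert_le e X
      have h3 := hr.insert_le e Y
      exact key X Y hX hY hd hu (by omega) (by omega)

namespace RankConn

variable {r : Finset α → ℤ} {S : Finset α} {e f : α}

theorem rank_singleton (hr : IsRank r) (hS : RankConn r S) (he : e ∈ S)
    (hne : (S.erase e).Nonempty) : r {e} = 1 := by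
  have h1 := hS {e} (S.erase e) (by simp) (by grind) (by simp) hne
  have h2 := hr.mono _ _ (Finset.erase_subset e S)
  have h3 := hr.singleton_le e
  omega

theorem rank_erase (hr : IsRank r) (hS : RankConn r S) (he : e ∈ S)
    (hne : (S.erase e).Nonempty) : r (S.erase e) = r S := by
  have h1 := hS {e} (S.erase e) (by simp) (by grind) (by simp) hne
  have h2 := hr.mono _ _ (Finset.erase_subset e S)
  have h3 := hr.singleton_le e
  omega

/-- Deleting an element in parallel with another one preserves connectedness. -/
theorem erase_of_parallel (hr : IsRank r) (hS : RankConn r S) (hf : f ∈ S) (hfe : f ≠ e)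
    (he : e ∈ S) (h : r {e, f} ≤ r {e}) : RankConn r (S.erase f) := by
  have key : ∀ X Y, Disjoint X Y → X ∪ Y = S.erase f → X.Nonempty → Y.Nonempty → e ∈ X →
      r (S.erase f) < r X + r Y := by
    intro X Y hd hu hX hY heX
    have hfXY : f ∉ X ∪ Y := by simp [hu]
    have h1 := hS (insert f X) Y (by rw [Finset.disjoint_insert_left]; grind)
      (by rw [Finset.insert_union, hu, Finset.insert_erase hf]) (by simp) hY
    have h2 := hr.marginal_anti (A := {e}) (B := X) (e := f) (by simpa) (by grind)
    have h3 := hr.mono _ _ (Finset.erase_subset f S)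
    rw [Finset.pair_comm] at h
    omega
  intro X Y hd hu hX hY
  have : e ∈ X ∪ Y := by rw [hu]; exact Finset.mem_erase.2 ⟨hfe.symm, he⟩
  rcases Finset.mem_union.1 this with h' | h'
  · exact key X Y hd hu hX hY h'
  · rw [add_comm]
    exact key Y X hd.symm (by rw [Finset.union_comm, hu]) hY hX h'

/-- Contracting an element in series with another one preserves connectedness. -/
theorem contract_of_series (hS : RankConn r S) (hf : f ∈ S) (hfe : f ≠ e)
    (he : e ∈ S) (hf1 : r {f} = 1)
    (h : ∀ A ⊆ S \ {e, f}, r (insert f A) = r A + 1) :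
    RankConn (contract r f) (S.erase f) := by
  have key : ∀ X Y, Disjoint X Y → X ∪ Y = S.erase f → X.Nonempty → Y.Nonempty → e ∈ X →
      contract r f (S.erase f) < contract r f X + contract r f Y := by
    intro X Y hd hu hX hY heX
    have hfXY : f ∉ X ∪ Y := by simp [hu]
    have h1 := hS (insert f X) Y (by rw [Finset.disjoint_insert_left]; grind)
      (by rw [Finset.insert_union, hu, Finset.insert_erase hf]) (by simp) hY
    have hY' : Y ⊆ S.erase f := hu ▸ Finset.subset_union_right
    have := Finset.disjoint_left.1 hd heX
    have h2 := h Y (by grind)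
    simp only [contract, Finset.insert_erase hf]
    omega
  intro X Y hd hu hX hY
  have : e ∈ X ∪ Y := by rw [hu]; exact Finset.mem_erase.2 ⟨hfe.symm, he⟩
  rcases Finset.mem_union.1 this with h' | h'
  · exact key X Y hd hu hX hY h'
  · rw [add_comm]
    exact key Y X hd.symm (by rw [Finset.union_comm, hu]) hY hX h'

end RankConn

section Tutte

variable {r : Finset α → ℤ} {S : Finset α} {q : ℝ} {v : α → ℝ} {e f : α}

theorem tutte_insert (hq : q ≠ 0) (hf : f ∉ S) :
    tutte r (insert f S) q v = tutte r S q v + v f * q ^ (-r {f}) * tutte (contract r f) S q v := by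
  rw [tutte, Finset.sum_powerset_insert hf, tutte, tutte, Finset.mul_sum]
  congr 1
  refine Finset.sum_congr rfl fun A hA => ?_
  rw [Finset.prod_insert fun h => hf (Finset.mem_powerset.1 hA h), contract,
    show -r (insert f A) = -r {f} + -(r (insert f A) - r {f}) by ring, zpow_add₀ hq]
  ring

theorem tutte_insert_insert (he : e ∉ S) (hf : f ∉ S) (hef : e ≠ f) :
    tutte r (insert f (insert e S)) q v = ∑ A ∈ S.powerset,
      (q ^ (-r A) + v e * q ^ (-r (insert e A)) + v f * q ^ (-r (insert f A)) +
        v e * v f * q ^ (-r (insert f (insert e A)))) * ∏ a ∈ A, v a := by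
  rw [tutte, Finset.sum_powerset_insert (by simp [hf, hef.symm]), Finset.sum_powerset_insert he,
    Finset.sum_powerset_insert he, ← Finset.sum_add_distrib, ← Finset.sum_add_distrib,
    ← Finset.sum_add_distrib]
  refine Finset.sum_congr rfl fun A hA => ?_
  have heA : e ∉ A := fun h => he (Finset.mem_powerset.1 hA h)
  have hfA : f ∉ A := fun h => hf (Finset.mem_powerset.1 hA h)
  rw [Finset.prod_insert heA, Finset.prod_insert hfA, Finset.prod_insert (by simp [hfA, hef.symm]),
    Finset.prod_insert heA]
  ring

theorem tutte_insert_update (he : e ∉ S) (w : ℝ) :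
    tutte r (insert e S) q (Function.update v e w) = ∑ A ∈ S.powerset,
      (q ^ (-r A) + w * q ^ (-r (insert e A))) * ∏ a ∈ A, v a := by
  rw [tutte, Finset.sum_powerset_insert he, ← Finset.sum_add_distrib]
  refine Finset.sum_congr rfl fun A hA => ?_
  have heA : e ∉ A := fun h => he (Finset.mem_powerset.1 hA h)
  rw [Finset.prod_insert heA, Finset.prod_update_of_notMem heA, Function.update_self]
  ring

/-- Parallel reduction. -/
theorem tutte_parallel (hr : IsRank r) (he : e ∉ S) (hf : f ∉ S) (hef : e ≠ f)
    (hle : r {e, f} ≤ r {e}) (hlf : r {e, f} ≤ r {f}) :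
    tutte r (insert f (insert e S)) q v =
      tutte r (insert e S) q (Function.update v e ((1 + v e) * (1 + v f) - 1)) := by
  rw [tutte_insert_insert he hf hef, tutte_insert_update he]
  refine Finset.sum_congr rfl fun A hA => ?_
  have heA : e ∉ A := fun h => he (Finset.mem_powerset.1 hA h)
  have hfA : f ∉ A := fun h => hf (Finset.mem_powerset.1 hA h)
  have h1 := hr.marginal_anti (A := {e}) (B := insert e A) (e := f) (by simp)
    (by simp [hfA, hef.symm])
  have h2 := hr.marginal_anti (A := {f}) (B := insert f A) (e := e) (by simp)
    (by simp [heA, hef])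
  have h3 := hr.mono _ _ (Finset.subset_insert f (insert e A))
  have h4 := hr.mono _ _ (Finset.subset_insert e (insert f A))
  rw [Finset.pair_comm] at h1
  rw [Finset.insert_comm] at h2 h4
  rw [show r (insert f A) = r (insert e A) by omega,
    show r (insert f (insert e A)) = r (insert e A) by omega]
  ring

/-- Series reduction. -/
theorem tutte_series (hq : q ≠ 0) (he : e ∉ S) (hf : f ∉ S) (hef : e ≠ f)
    (hD : q + v e + v f ≠ 0) (hf1 : r {f} = 1)
    (hre : ∀ A ⊆ S, r (insert e A) = r A + 1) (hrf : ∀ A ⊆ S, r (insert f A) = r A + 1) :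
    tutte r (insert f (insert e S)) q v = (q + v e + v f) / q *
      tutte (contract r f) (insert e S) q
        (Function.update v e (v e * v f / (q + v e + v f))) := by
  rw [tutte_insert_insert he hf hef, tutte_insert_update he, Finset.mul_sum]
  refine Finset.sum_congr rfl fun A hA => ?_
  rw [Finset.mem_powerset] at hA
  rw [hre A hA, hrf A hA, contract, contract, hrf A hA, hf1,
    add_sub_cancel_right, neg_add, neg_sub, sub_eq_neg_add, zpow_add₀ hq, zpow_add₀ hq, zpow_one,
    zpow_neg_one]
  field_simp

theorem tutte_union_of_additive (hq : q ≠ 0) {X Y : Finset α} (hd : Disjoint X Y)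
    (h : ∀ A ⊆ X, ∀ B ⊆ Y, r (A ∪ B) = r A + r B) :
    tutte r (X ∪ Y) q v = tutte r X q v * tutte r Y q v := by
  rw [tutte, tutte, tutte, Finset.sum_mul_sum, ← Finset.sum_product']
  symm
  refine Finset.sum_bij' (fun p _ => p.1 ∪ p.2) (fun A _ => (A ∩ X, A ∩ Y)) ?_ ?_ ?_ ?_ ?_
  · rintro ⟨A, B⟩ hp
    simp only [Finset.mem_product, Finset.mem_powerset] at hp ⊢
    exact Finset.union_subset_union hp.1 hp.2
  · intro A _
    simp
  · rintro ⟨A, B⟩ hp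
    simp only [Finset.mem_product, Finset.mem_powerset] at hp
    have h1 : ∀ a, a ∈ X → a ∉ Y := fun a h => Finset.disjoint_left.1 hd h
    rw [Prod.mk.injEq]
    constructor <;> ext a <;> have := h1 a <;> have := @hp.1 a <;> have := @hp.2 a <;> grind
  · intro A hA
    rw [← Finset.inter_union_distrib_left, Finset.inter_eq_left]
    exact Finset.mem_powerset.1 hA
  · rintro ⟨A, B⟩ hp
    simp only [Finset.mem_product, Finset.mem_powerset] at hp ⊢
    rw [h A hp.1 B hp.2, Finset.prod_union (Finset.disjoint_of_subset_left hp.1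
      (Finset.disjoint_of_subset_right hp.2 hd)), neg_add, zpow_add₀ hq]
    ring

end Tutte

/-- The weight interval, closed under parallel and series reduction when
`q = 1 + a - a ^ 2 - a ^ 3`. -/
def weights (a : ℝ) : Set ℝ := Set.Icc (-1 - a) (-1 + a ^ 2)

section weights

variable {a x y : ℝ}

theorem parallel_mem_weights (ha : 0 < a) (ha3 : a ≤ 1 / 3) (hx : x ∈ weights a)
    (hy : y ∈ weights a) : (1 + x) * (1 + y) - 1 ∈ weights a := by
  obtain ⟨hx1, hx2⟩ := hx
  obtain ⟨hy1, hy2⟩ := hy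
  have ha2 : a ^ 2 ≤ a := by nlinarith
  have hx' : |1 + x| ≤ a := abs_le.2 ⟨by linarith, by linarith⟩
  have hy' : |1 + y| ≤ a := abs_le.2 ⟨by linarith, by linarith⟩
  have h : |(1 + x) * (1 + y)| ≤ a * a := by
    rw [abs_mul]; exact mul_le_mul hx' hy' (abs_nonneg _) ha.le
  rw [abs_le] at h
  constructor <;> nlinarith

theorem q_lt_neg_add (ha : 0 < a) (ha3 : a ≤ 1 / 3) (hx : x ∈ weights a)
    (hy : y ∈ weights a) : 1 + a - a ^ 2 - a ^ 3 + x + y < 0 := by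
  obtain ⟨hx1, hx2⟩ := hx
  obtain ⟨hy1, hy2⟩ := hy
  have : 0 < (1 - a) * (1 - a ^ 2) := mul_pos (by linarith) (by nlinarith)
  nlinarith

theorem series_mem_weights (ha : 0 < a) (ha3 : a ≤ 1 / 3) (hx : x ∈ weights a)
    (hy : y ∈ weights a) : x * y / (1 + a - a ^ 2 - a ^ 3 + x + y) ∈ weights a := by
  have hD := q_lt_neg_add ha ha3 hx hy
  obtain ⟨hx1, hx2⟩ := hx
  obtain ⟨hy1, hy2⟩ := hy
  have h1 : 0 < 1 - a ^ 2 := by nlinarith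
  constructor
  · rw [le_div_iff_of_neg hD]
    nlinarith [mul_nonneg (sub_nonneg.2 hx2) (by linarith : 0 ≤ a + 1 + y),
      mul_nonneg (sub_nonneg.2 hy2) (by nlinarith : 0 ≤ a + a ^ 2)]
  · rw [div_le_iff_of_neg hD]
    nlinarith [mul_nonneg (sub_nonneg.2 hx2) (sub_nonneg.2 hy2),
      mul_nonneg h1.le (mul_nonneg ha.le h1.le)]

theorem parallel_gt (ha : 0 < a) (ha3 : a ≤ 1 / 3) (hx : x ∈ weights a)
    (hy : y ∈ weights a) : 0 < 1 + a - a ^ 2 - a ^ 3 + ((1 + x) * (1 + y) - 1) := by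
  obtain ⟨hx1, hx2⟩ := hx
  obtain ⟨hy1, hy2⟩ := hy
  have ha2 : a ^ 2 ≤ a / 3 := by nlinarith
  have ha3 : a ^ 3 ≤ a / 9 := by nlinarith
  have hx' : |1 + x| ≤ a := abs_le.2 ⟨by linarith, by linarith⟩
  have hy' : |1 + y| ≤ a := abs_le.2 ⟨by linarith, by linarith⟩
  have h : |(1 + x) * (1 + y)| ≤ a * a := by
    rw [abs_mul]; exact mul_le_mul hx' hy' (abs_nonneg _) ha.le
  rw [abs_le] at h
  nlinarith

end weights

/-- The sign of the multivariate Tutte polynomial of a connected matroid with at least two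
elements. -/
theorem RankConn.tutte_sign {a : ℝ} (ha : 0 < a) (ha3 : a ≤ 1 / 3) {r : Finset α → ℤ}
    {S : Finset α} {v : α → ℝ} (hr : IsRank r) (hcard : 2 ≤ S.card) (hS : RankConn r S)
    (hv : ∀ e ∈ S, v e ∈ weights a) :
    0 < (-1 : ℝ) ^ (r S + 1) * tutte r S (1 + a - a ^ 2 - a ^ 3) v := by
  induction hn : S.card using Nat.strong_induction_on generalizing r S v with
  | _ n ih =>
  subst hn
  set q := 1 + a - a ^ 2 - a ^ 3 with hq
  have hq0 : 0 < q := by nlinarith [mul_nonneg ha.le ha.le, mul_nonneg ha.le (mul_nonneg ha.le ha.le)]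
  have hupd : ∀ T : Finset α, T ⊆ S → ∀ e w, w ∈ weights a →
      ∀ b ∈ T, Function.update v e w b ∈ weights a := by
    intro T hT e w hw b hb
    rcases eq_or_ne b e with rfl | hbe
    · rwa [Function.update_self]
    · rw [Function.update_of_ne hbe]; exact hv b (hT hb)
  by_cases h2 : S.card = 2
  · obtain ⟨e, f, hef, rfl⟩ := Finset.card_eq_two.1 h2
    have h1 := hS {e} {f} (by simpa using hef) rfl (by simp) (by simp)
    have he := hr.singleton_le e
    have hf := hr.singleton_le f
    have he' := hr.mono {e} {e, f} (by simp)
    have hf' := hr.mono {f} {e, f} (by simp)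
    have hve := hv e (by simp)
    have hvf := hv f (by simp)
    have hpos := parallel_gt ha ha3 hve hvf
    have hr1 : r {e, f} = 1 := by omega
    have h3 := tutte_parallel (q := q) (v := v) hr (Finset.notMem_empty e)
      (Finset.notMem_empty f) hef (by omega) (by omega)
    rw [tutte_insert_update (Finset.notMem_empty e)] at h3
    simp only [insert_empty_eq, Finset.powerset_empty, Finset.sum_singleton, hr.empty,
      show r {e} = 1 by omega, Finset.prod_empty] at h3
    rw [Finset.pair_comm] at h3
    rw [h3, hr1]
    norm_num
    rw [show 1 + ((1 + v e) * (1 + v f) - 1) * q⁻¹ = (q + ((1 + v e) * (1 + v f) - 1)) / q by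
      field_simp]
    positivity
  have hne1 : ∀ e ∈ S, (S.erase e).Nonempty := fun e he => Finset.card_pos.1 (by
    rw [Finset.card_erase_of_mem he]; omega)
  have hneg : ∀ e ∈ S, v e < 0 := fun e he => by
    have := (hv e he).2
    nlinarith
  rcases hS.exists_reduction hr (Finset.card_pos.1 (by omega)) with
    ⟨e, he, hd, hc⟩ | ⟨e, f, hef, hsub, -, hlam⟩
  · have hre := hS.rank_singleton hr he (hne1 e he)
    have hrS := hS.rank_erase hr he (hne1 e he)
    have hlt := Finset.card_erase_lt_of_mem he
    have hle : 2 ≤ (S.erase e).card := by rw [Finset.card_erase_of_mem he]; omega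
    have hv' : ∀ b ∈ S.erase e, v b ∈ weights a := fun b hb => hv b (Finset.mem_of_mem_erase hb)
    have i1 := ih _ hlt hr hle hd hv' rfl
    have i2 := ih _ hlt (hr.contract e) hle hc hv' rfl
    have hex := tutte_insert (r := r) (v := v) hq0.ne' (Finset.notMem_erase e S)
    rw [Finset.insert_erase he, hre] at hex
    rw [contract, Finset.insert_erase he, hre, sub_add_cancel] at i2
    rw [hrS] at i1
    rw [hex, mul_add]
    refine add_pos i1 ?_
    rw [zpow_add₀ (by norm_num : (-1 : ℝ) ≠ 0), zpow_one,
      show (-1 : ℝ) ^ r S * -1 * (v e * q ^ (-1 : ℤ) * tutte (contract r e) (S.erase e) q v) =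
        -v e * q ^ (-1 : ℤ) * ((-1) ^ r S * tutte (contract r e) (S.erase e) q v) by ring]
    exact mul_pos (mul_pos (neg_pos.2 (hneg e he)) (zpow_pos hq0 _)) i2
  · have heS : e ∈ S := hsub (by simp)
    have hfS : f ∈ S := hsub (by simp)
    have hre := hS.rank_singleton hr heS (hne1 e heS)
    have hrf := hS.rank_singleton hr hfS (hne1 f hfS)
    have hrSe := hS.rank_erase hr heS (hne1 e heS)
    have hrSf := hS.rank_erase hr hfS (hne1 f hfS)
    have hlt := Finset.card_erase_lt_of_mem hfS
    have hle : 2 ≤ (S.erase f).card := by rw [Finset.card_erase_of_mem hfS]; omega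
    have heT : e ∉ S \ {e, f} := by simp
    have hfT : f ∉ S \ {e, f} := by simp
    have hTe : insert e (S \ {e, f}) = S.erase f := by grind
    have hTf : insert f (S \ {e, f}) = S.erase e := by grind
    have hve := hv e heS
    have hvf := hv f hfS
    by_cases hpar : r {e, f} ≤ 1
    · have h3 := tutte_parallel (q := q) (v := v) hr heT hfT hef (by omega) (by omega)
      rw [hTe, Finset.insert_erase hfS] at h3
      rw [h3, ← hrSf]
      exact ih _ hlt hr hle (hS.erase_of_parallel hr hfS hef.symm heS (by omega))
        (hupd _ (Finset.erase_subset _ _) _ _ (parallel_mem_weights ha ha3 hve hvf)) rfl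
    · have me : ∀ A ⊆ S \ {e, f}, r (insert e A) = r A + 1 := fun A hA => by
        have h1 := hr.marginal_anti hA heT
        have h2 := hr.insert_le e A
        rw [hTe] at h1
        omega
      have mf : ∀ A ⊆ S \ {e, f}, r (insert f A) = r A + 1 := fun A hA => by
        have h1 := hr.marginal_anti hA hfT
        have h2 := hr.insert_le f A
        rw [hTf] at h1
        omega
      have hD := q_lt_neg_add ha ha3 hve hvf
      rw [← hq] at hD
      have h3 := tutte_series (v := v) hq0.ne' heT hfT hef hD.ne hrf me mf
      rw [hTe, Finset.insert_erase hfS] at h3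
      have i1 := ih _ hlt (hr.contract f) hle (hS.contract_of_series hfS hef.symm heS hrf mf)
        (hupd _ (Finset.erase_subset _ _) e _ (series_mem_weights ha ha3 hve hvf)) rfl
      rw [← hq, contract, Finset.insert_erase hfS, hrf, sub_add_cancel] at i1
      rw [h3, zpow_add₀ (by norm_num : (-1 : ℝ) ≠ 0), zpow_one]
      have := mul_pos (div_pos (neg_pos.2 hD) hq0) i1
      refine this.trans_eq ?_
      ring

/-- The connected components of the restriction to `S`. -/
def IsRankComp (r : Finset α → ℤ) (S P : Finset α) : Prop :=
  Maximal (fun P => P ⊆ S ∧ P.Nonempty ∧ RankConn r P) P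

section components

variable {r : Finset α → ℤ}

theorem IsRank.union_additive (hr : IsRank r) {X Y : Finset α} (hd : Disjoint X Y)
    (h : r X + r Y ≤ r (X ∪ Y)) : ∀ A ⊆ X, ∀ B ⊆ Y, r (A ∪ B) = r A + r B := by
  intro A hA B hB
  have h1 := hr.submod (A ∪ Y) X
  have hA' := fun a => @hA a
  have hB' := fun a => @hB a
  have hd' : ∀ a, a ∈ X → a ∉ Y := fun a h => Finset.disjoint_left.1 hd h
  rw [show (A ∪ Y) ∪ X = X ∪ Y by grind,
    show (A ∪ Y) ∩ X = A by ext a; have := hd' a; grind] at h1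
  have h2 := hr.submod (A ∪ B) Y
  rw [show (A ∪ B) ∪ Y = A ∪ Y by grind,
    show (A ∪ B) ∩ Y = B by ext a; have := hd' a; grind] at h2
  have h3 := hr.union_le A B
  omega

theorem RankConn.subset_or_subset {X Y F : Finset α} (hd : Disjoint X Y)
    (h : ∀ A ⊆ X, ∀ B ⊆ Y, r (A ∪ B) = r A + r B) (hF : RankConn r F) (hFXY : F ⊆ X ∪ Y) :
    F ⊆ X ∨ F ⊆ Y := by
  have e1 : F ∩ X ∪ F ∩ Y = F := by
    rw [← Finset.inter_union_distrib_left]; exact Finset.inter_eq_left.2 hFXY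
  rcases (F ∩ X).eq_empty_or_nonempty with h1 | h1
  · rw [h1, Finset.empty_union] at e1
    exact Or.inr (Finset.inter_eq_left.1 e1)
  rcases (F ∩ Y).eq_empty_or_nonempty with h2 | h2
  · rw [h2, Finset.union_empty] at e1
    exact Or.inl (Finset.inter_eq_left.1 e1)
  have h3 := hF _ _ (Finset.disjoint_of_subset_left Finset.inter_subset_right
    (Finset.disjoint_of_subset_right Finset.inter_subset_right hd)) e1 h1 h2
  have h4 := h _ (Finset.inter_subset_right (s₁ := F)) _ (Finset.inter_subset_right (s₁ := F))
  rw [e1] at h4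
  omega

theorem isRankComp_union {X Y : Finset α} (hd : Disjoint X Y)
    (h : ∀ A ⊆ X, ∀ B ⊆ Y, r (A ∪ B) = r A + r B) (P : Finset α) :
    IsRankComp r (X ∪ Y) P ↔ IsRankComp r X P ∨ IsRankComp r Y P := by
  have key : ∀ X Y : Finset α, Disjoint X Y →
      (∀ F ⊆ X ∪ Y, RankConn r F → F ⊆ X ∨ F ⊆ Y) →
      IsRankComp r X P → IsRankComp r (X ∪ Y) P := by
    rintro X Y hd hsub ⟨⟨h1, h2, h3⟩, h4⟩
    refine ⟨⟨h1.trans Finset.subset_union_left, h2, h3⟩, fun Q hQ hPQ => ?_⟩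
    rcases hsub Q hQ.1 hQ.2.2 with h | h
    · exact h4 ⟨h, hQ.2⟩ hPQ
    · obtain ⟨p, hp⟩ := h2
      exact absurd (h (hPQ hp)) (Finset.disjoint_left.1 hd (h1 hp))
  have hsub : ∀ F ⊆ X ∪ Y, RankConn r F → F ⊆ X ∨ F ⊆ Y :=
    fun F hF hc => hc.subset_or_subset hd h hF
  constructor
  · rintro ⟨⟨h1, h2, h3⟩, h4⟩
    rcases hsub P h1 h3 with h | h
    · exact Or.inl ⟨⟨h, h2, h3⟩, fun Q hQ =>
        h4 ⟨hQ.1.trans Finset.subset_union_left, hQ.2⟩⟩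
    · exact Or.inr ⟨⟨h, h2, h3⟩, fun Q hQ =>
        h4 ⟨hQ.1.trans Finset.subset_union_right, hQ.2⟩⟩
  · rintro (h | h)
    · exact key X Y hd hsub h
    · rw [Finset.union_comm]
      exact key Y X hd.symm (fun F hF hc => (hsub F (by rwa [Finset.union_comm]) hc).symm) h

/-- The sign of the chromatic specialisation for a loopless matroid. -/
theorem IsRank.tutte_neg_one_sign {a : ℝ} (ha : 0 < a) (ha3 : a ≤ 1 / 3) (hr : IsRank r)
    (S : Finset α) (hloop : ∀ e ∈ S, r {e} = 1) :
    0 < (-1 : ℝ) ^ (r S + {P | IsRankComp r S P}.ncard) *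
      tutte r S (1 + a - a ^ 2 - a ^ 3) fun _ => -1 := by
  induction hn : S.card using Nat.strong_induction_on generalizing S with
  | _ n ih =>
  subst hn
  set q := 1 + a - a ^ 2 - a ^ 3 with hq
  have hq0 : 1 < q := by nlinarith [mul_pos ha ha, mul_pos ha (mul_pos ha ha)]
  rcases S.eq_empty_or_nonempty with rfl | hne
  · have : {P | IsRankComp r ∅ P} = ∅ := by
      ext P
      simp only [Set.mem_ofPred_eq, Set.mem_empty_iff_false, iff_false]
      rintro ⟨⟨h1, h2, -⟩, -⟩
      exact h2.ne_empty (Finset.subset_empty.1 h1)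
    simp [this, tutte, hr.empty]
  by_cases hS : RankConn r S
  · have : {P | IsRankComp r S P} = {S} := by
      ext P
      simp only [Set.mem_ofPred_eq, Set.mem_singleton_iff]
      constructor
      · rintro ⟨⟨h1, -, -⟩, h4⟩
        exact h1.antisymm (h4 ⟨subset_rfl, hne, hS⟩ h1)
      · rintro rfl
        exact ⟨⟨subset_rfl, hne, hS⟩, fun Q hQ _ => hQ.1⟩
    rw [this, Set.ncard_singleton, Nat.cast_one]
    by_cases h1 : S.card = 1
    · obtain ⟨e, rfl⟩ := Finset.card_eq_one.1 h1
      have he := hloop e (by simp)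
      have hinv : q⁻¹ < 1 := inv_lt_one_of_one_lt₀ hq0
      rw [tutte, ← insert_empty_eq, Finset.sum_powerset_insert (by simp)]
      norm_num [hr.empty, he]
      exact hinv
    · have := hne.card_pos
      refine hS.tutte_sign ha ha3 hr (by omega) fun e _ => ⟨by linarith, by nlinarith⟩
  · simp only [RankConn, not_forall, not_lt] at hS
    obtain ⟨X, Y, hd, rfl, hX, hY, h⟩ := hS
    have hadd := hr.union_additive hd h
    have hcard := Finset.card_union_of_disjoint hd
    have hX' := hX.card_pos
    have hY' := hY.card_pos
    have i1 := ih _ (by omega) X (fun e he => hloop e (Finset.mem_union_left _ he)) rfl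
    have i2 := ih _ (by omega) Y (fun e he => hloop e (Finset.mem_union_right _ he)) rfl
    have hfin : ∀ S : Finset α, {P | IsRankComp r S P}.Finite := fun S =>
      S.powerset.finite_toSet.subset fun P hP => Finset.mem_coe.2 (Finset.mem_powerset.2 hP.1.1)
    have hset : {P | IsRankComp r (X ∪ Y) P} =
        {P | IsRankComp r X P} ∪ {P | IsRankComp r Y P} := by
      ext P; exact isRankComp_union hd hadd P
    have hdis : Disjoint {P | IsRankComp r X P} {P | IsRankComp r Y P} := by
      rw [Set.disjoint_left]
      rintro P hPX hPY
      obtain ⟨p, hp⟩ := hPX.1.2.1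
      exact Finset.disjoint_left.1 hd (hPX.1.1 hp) (hPY.1.1 hp)
    rw [hset, Set.ncard_union_eq hdis (hfin X) (hfin Y), hadd X subset_rfl Y subset_rfl,
      tutte_union_of_additive (by positivity) hd hadd, Nat.cast_add, add_add_add_comm,
      zpow_add₀ (by norm_num)]
    refine (mul_pos i1 i2).trans_eq ?_
    ring

end components

end ChromaticSign

namespace Multigraph

open ChromaticSign

section rank

variable (G : Multigraph)

/-- The functions on vertices which are constant along the edges in `A`. -/
def constOn (R : Type*) [Ring R] (A : Finset G.E) : Submodule R (G.V → R) where
  carrier := {g | ∀ e ∈ A, g (G.src e) = g (G.tgt e)}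
  add_mem' hg hh e he := by simp [hg e he, hh e he]
  zero_mem' _ _ := rfl
  smul_mem' c g hg e he := by simp [hg e he]

/-- The equivalence relation whose quotient is counted by `numComponentsOn`. -/
abbrev componentSetoid (A : Finset G.E) : Setoid G.V :=
  Relation.EqvGen.setoid (fun x y => ∃ e ∈ A, G.src e = x ∧ G.tgt e = y)

theorem eqvGen_congr {V β : Type*} {s : V → V → Prop} {f : V → β}
    (h : ∀ a b, s a b → f a = f b) {a b : V} (hab : Relation.EqvGen s a b) : f a = f b := by
  induction hab with
  | rel _ _ h' => exact h _ _ h'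
  | refl _ => rfl
  | symm _ _ _ ih => exact ih.symm
  | trans _ _ _ _ _ ih1 ih2 => exact ih1.trans ih2

/-- Functions constant along the edges in `A` are functions on components. -/
def constEquiv (β : Type*) (A : Finset G.E) :
    (Quotient (G.componentSetoid A) → β) ≃
      {f : G.V → β // ∀ e ∈ A, f (G.src e) = f (G.tgt e)} where
  toFun g := ⟨fun v => g (Quotient.mk _ v), fun e he =>
    congrArg g (Quotient.sound (Relation.EqvGen.rel _ _ ⟨e, he, rfl, rfl⟩))⟩
  invFun f := Quotient.lift f.1 fun _ _ h => eqvGen_congr (f := f.1) (by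
    rintro _ _ ⟨e, he, rfl, rfl⟩
    exact f.2 e he) h
  left_inv g := by
    ext x
    induction x using Quotient.inductionOn
    rfl
  right_inv f := rfl

theorem finrank_constOn (A : Finset G.E) :
    Module.finrank ℝ (G.constOn ℝ A) = G.numComponentsOn A := by
  classical
  have e : (Quotient (G.componentSetoid A) → ℝ) ≃ₗ[ℝ] G.constOn ℝ A :=
    { G.constEquiv ℝ A with
      map_add' := fun _ _ => rfl
      map_smul' := fun _ _ => rfl }
  rw [← e.finrank_eq, Module.finrank_fintype_fun_eq_card, numComponentsOn,
    Nat.card_eq_fintype_card]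

theorem card_const (A : Finset G.E) (t : ℕ) :
    Nat.card {f : G.V → Fin t // ∀ e ∈ A, f (G.src e) = f (G.tgt e)} =
      t ^ G.numComponentsOn A := by
  rw [← Nat.card_congr (G.constEquiv (Fin t) A), Nat.card_fun, Nat.card_fin, numComponentsOn]

/-- The rank function of the cycle matroid of `G`. -/
noncomputable def rank (A : Finset G.E) : ℤ := Fintype.card G.V - G.numComponentsOn A

theorem constOn_union (A B : Finset G.E) :
    G.constOn ℝ (A ∪ B) = G.constOn ℝ A ⊓ G.constOn ℝ B := by
  ext g
  simp only [Submodule.mem_inf]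
  constructor
  · exact fun h => ⟨fun e he => h e (Finset.mem_union_left _ he),
      fun e he => h e (Finset.mem_union_right _ he)⟩
  · rintro ⟨h1, h2⟩ e he
    exact (Finset.mem_union.1 he).elim (h1 e) (h2 e)

theorem constOn_anti {A B : Finset G.E} (h : A ⊆ B) : G.constOn ℝ B ≤ G.constOn ℝ A :=
  fun _ hg e he => hg e (h he)

/-- The coboundary of a function on vertices, evaluated at the edge `e`. -/
def coboundary (e : G.E) : (G.V → ℝ) →ₗ[ℝ] ℝ :=
  LinearMap.proj (R := ℝ) (φ := fun _ : G.V => ℝ) (G.src e) - LinearMap.proj (G.tgt e)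

theorem constOn_singleton (e : G.E) : G.constOn ℝ {e} = LinearMap.ker (G.coboundary e) := by
  ext g
  simp [constOn, coboundary, sub_eq_zero]

theorem isRank_rank : IsRank G.rank where
  empty := by
    have : G.constOn ℝ ∅ = ⊤ := eq_top_iff.2 fun _ _ e he => absurd he (Finset.notMem_empty e)
    rw [rank, ← finrank_constOn, this, finrank_top, Module.finrank_fintype_fun_eq_card, sub_self]
  mono A B h := by
    have := Submodule.finrank_mono (G.constOn_anti h)
    rw [finrank_constOn, finrank_constOn] at this
    simp only [rank]; omega
  submod A B := by
    have h1 := Submodule.finrank_sup_add_finrank_inf_eq (G.constOn ℝ A) (G.constOn ℝ B)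
    have h2 := Submodule.finrank_mono (sup_le
      (G.constOn_anti (Finset.inter_subset_left (s₁ := A) (s₂ := B)))
      (G.constOn_anti (Finset.inter_subset_right (s₁ := A) (s₂ := B))))
    rw [← constOn_union] at h1
    simp only [finrank_constOn] at h1 h2
    simp only [rank]; omega
  singleton_le e := by
    have h1 := LinearMap.finrank_range_add_finrank_ker (G.coboundary e)
    have h2 := Submodule.finrank_le (LinearMap.range (G.coboundary e))
    rw [← constOn_singleton, finrank_constOn, Module.finrank_fintype_fun_eq_card] at h1
    rw [Module.finrank_self] at h2
    simp only [rank]; omega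

theorem rank_singleton {e : G.E} (he : G.src e ≠ G.tgt e) : G.rank {e} = 1 := by
  refine le_antisymm (G.isRank_rank.singleton_le e) ?_
  have h1 : G.constOn ℝ {e} < ⊤ := by
    refine lt_top_iff_ne_top.2 fun h => ?_
    have h2 : Pi.single (G.src e) (1 : ℝ) ∈ G.constOn ℝ {e} := h ▸ Submodule.mem_top
    have h3 := h2 e (Finset.mem_singleton_self e)
    rw [Pi.single_eq_same, Pi.single_eq_of_ne he.symm] at h3
    exact one_ne_zero h3
  have h2 := Submodule.finrank_lt_finrank_of_lt h1
  rw [finrank_constOn, finrank_top, Module.finrank_fintype_fun_eq_card] at h2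
  simp only [rank]; omega

theorem rank_add_le_iff (X Y : Finset G.E) :
    G.rank X + G.rank Y ≤ G.rank (X ∪ Y) ↔ G.constOn ℝ X ⊔ G.constOn ℝ Y = ⊤ := by
  have h1 := Submodule.finrank_sup_add_finrank_inf_eq (G.constOn ℝ X) (G.constOn ℝ Y)
  have h2 := Submodule.finrank_le (G.constOn ℝ X ⊔ G.constOn ℝ Y)
  have h3 : Module.finrank ℝ (G.V → ℝ) = Fintype.card G.V := Module.finrank_fintype_fun_eq_card ℝ
  rw [← constOn_union, finrank_constOn, finrank_constOn, finrank_constOn] at h1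
  simp only [rank]
  constructor
  · intro h
    exact Submodule.eq_top_of_finrank_eq (by omega)
  · intro h
    rw [h, finrank_top] at h1
    omega

/-- Whitney's expansion of the chromatic polynomial. -/
theorem properColorings_eq_sum (t : ℕ) : (G.properColorings t : ℝ) =
    ∑ A : Finset G.E, (-1) ^ A.card * (t : ℝ) ^ G.numComponentsOn A := by
  classical
  have h1 : ∀ f : G.V → Fin t, (if ∀ e, f (G.src e) ≠ f (G.tgt e) then (1 : ℝ) else 0) =
      ∑ A : Finset G.E, (-1) ^ A.card * if ∀ e ∈ A, f (G.src e) = f (G.tgt e) then 1 else 0 := by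
    intro f
    calc (if ∀ e, f (G.src e) ≠ f (G.tgt e) then (1 : ℝ) else 0)
        = ∏ e : G.E, (1 + -if f (G.src e) = f (G.tgt e) then (1 : ℝ) else 0) := by
          have := Finset.prod_boole (s := Finset.univ) (M₀ := ℝ)
            (p := fun e => f (G.src e) ≠ f (G.tgt e))
          simp only [Finset.mem_univ, true_imp_iff] at this
          rw [← this]
          refine Finset.prod_congr rfl fun e _ => ?_
          by_cases h : f (G.src e) = f (G.tgt e) <;> simp [h]
      _ = _ := by
          rw [Finset.prod_one_add, Finset.powerset_univ]
          refine Finset.sum_congr rfl fun A _ => ?_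
          rw [Finset.prod_neg, Finset.prod_boole]
          congr
  rw [properColorings, Nat.card_eq_fintype_card, Fintype.card_subtype, Finset.card_filter,
    Nat.cast_sum]
  simp only [Nat.cast_ite, Nat.cast_one, Nat.cast_zero]
  rw [Finset.sum_congr rfl fun f _ => h1 f, Finset.sum_comm]
  refine Finset.sum_congr rfl fun A _ => ?_
  rw [← Finset.mul_sum, Finset.sum_boole, ← Fintype.card_subtype, ← Nat.card_eq_fintype_card,
    card_const, Nat.cast_pow]

theorem IsChromaticPoly.eval_eq_sum {G : Multigraph} {P : ℝ[X]} (hP : G.IsChromaticPoly P)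
    (t : ℝ) : P.eval t = ∑ A : Finset G.E, (-1) ^ A.card * t ^ G.numComponentsOn A := by
  have : P = ∑ A : Finset G.E, C ((-1) ^ A.card) * X ^ G.numComponentsOn A := by
    refine Polynomial.eq_of_infinite_eval_eq _ _ (Set.Infinite.mono ?_
      (Set.infinite_range_of_injective (f := fun n : ℕ => ((n + 1 : ℕ) : ℝ))
        fun m n h => by simpa using h))
    rintro _ ⟨n, rfl⟩
    simp only [Set.mem_ofPred_eq]
    rw [hP _ n.succ_pos, properColorings_eq_sum, Polynomial.eval_finsetSum]
    simp
  rw [this, Polynomial.eval_finsetSum]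
  simp

theorem IsChromaticPoly.eval_eq_tutte {G : Multigraph} {P : ℝ[X]} (hP : G.IsChromaticPoly P)
    {t : ℝ} (ht : t ≠ 0) : P.eval t =
      t ^ Fintype.card G.V * tutte G.rank Finset.univ t fun _ => -1 := by
  rw [hP.eval_eq_sum, tutte, Finset.powerset_univ, Finset.mul_sum]
  refine Finset.sum_congr rfl fun A _ => ?_
  rw [Finset.prod_const, rank, neg_sub, zpow_sub₀ ht, zpow_natCast, zpow_natCast]
  field_simp

end rank

section blocks

variable {G : Multigraph}

/-- The subgraph formed by a set of edges and their endpoints. -/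
def edgeSubgr (F : Finset G.E) : Subgr G where
  verts := {v | ∃ e ∈ F, G.src e = v ∨ G.tgt e = v}
  edges := F
  src_mem e he := ⟨e, he, Or.inl rfl⟩
  tgt_mem e he := ⟨e, he, Or.inr rfl⟩

theorem Subgr.ext_of_eq {H K : Subgr G} (hv : H.verts = K.verts) (he : H.edges = K.edges) :
    H = K := by
  cases H; cases K; cases hv; cases he; rfl

theorem Subgr.ConnIn.eq_edgeSubgr {H : Subgr G} (hH : H.ConnIn) {F : Finset G.E}
    (hF : (F : Set G.E) = H.edges) (hne : F.Nonempty) : H = edgeSubgr F := by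
  refine Subgr.ext_of_eq (Set.Subset.antisymm (fun w hw => ?_) ?_) hF.symm
  · obtain ⟨e, he⟩ := hne
    have he' : e ∈ H.edges := hF ▸ Finset.mem_coe.2 he
    have := eqvGen_congr (f := fun v => v ∈ (edgeSubgr F).verts) (by
      rintro _ _ ⟨e, he, rfl, rfl⟩
      rw [← hF] at he
      exact propext ⟨fun _ => (edgeSubgr F).tgt_mem e he, fun _ => (edgeSubgr F).src_mem e he⟩)
      (hH.2 w hw _ (H.src_mem e he'))
    exact this.mpr ((edgeSubgr F).src_mem e he)
  · rintro w ⟨e, he, rfl | rfl⟩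
    · exact H.src_mem e (hF ▸ Finset.mem_coe.2 he)
    · exact H.tgt_mem e (hF ▸ Finset.mem_coe.2 he)

theorem Subgr.Nonseparable.rankConn (hG : G.Loopless) {H : Subgr G} (hH : H.Nonseparable)
    {F : Finset G.E} (hF : (F : Set G.E) = H.edges) : RankConn G.rank F := by
  rintro X Y - rfl ⟨x, hx⟩ ⟨y, hy⟩
  by_contra! hle
  rw [rank_add_le_iff] at hle
  have hmem : ∀ e, e ∈ H.edges ↔ e ∈ X ∨ e ∈ Y := fun e => by
    rw [← hF, Finset.mem_coe, Finset.mem_union]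
  have hXH : ∀ e ∈ X, e ∈ H.edges := fun e he => (hmem e).2 (Or.inl he)
  have hYH : ∀ e ∈ Y, e ∈ H.edges := fun e he => (hmem e).2 (Or.inr he)
  obtain ⟨v, ⟨e, he, hev⟩, ⟨e', he', hev'⟩⟩ :
      ∃ v, v ∈ (edgeSubgr X).verts ∧ v ∈ (edgeSubgr Y).verts := by
    by_contra! hno
    have := eqvGen_congr (f := fun v => v ∈ (edgeSubgr X).verts) (by
      rintro _ _ ⟨e, he, rfl, rfl⟩
      rcases (hmem e).1 he with he | he
      · exact propext ⟨fun _ => (edgeSubgr X).tgt_mem e he, fun _ => (edgeSubgr X).src_mem e he⟩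
      · exact propext ⟨fun h => absurd ((edgeSubgr Y).src_mem e he) (hno _ h),
          fun h => absurd ((edgeSubgr Y).tgt_mem e he) (hno _ h)⟩)
      (hH.1.2 _ (H.src_mem x (hXH x hx)) _ (H.src_mem y (hYH y hy)))
    exact hno _ (this.mp ((edgeSubgr X).src_mem x hx)) ((edgeSubgr Y).src_mem y hy)
  have other : ∀ Z : Finset G.E, (∀ e ∈ Z, e ∈ H.edges) → ∀ e ∈ Z, G.src e = v ∨ G.tgt e = v →
      ∃ u ∈ H.verts, u ≠ v ∧ ∀ g ∈ G.constOn ℝ Z, g u = g v := by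
    rintro Z hZ e he (rfl | rfl)
    · exact ⟨_, H.tgt_mem e (hZ e he), (hG e).symm, fun g hg => (hg e he).symm⟩
    · exact ⟨_, H.src_mem e (hZ e he), hG e, fun g hg => hg e he⟩
  obtain ⟨u, hu, huv, hgu⟩ := other X hXH e he hev
  obtain ⟨w, hw, hwv, hgw⟩ := other Y hYH e' he' hev'
  have hvH : v ∈ H.verts := by
    rcases hev with rfl | rfl
    · exact H.src_mem e (hXH e he)
    · exact H.tgt_mem e (hXH e he)
  have hconn := (hH.2 v hvH).resolve_left (Set.Nonempty.ne_empty ⟨u, hu, huv⟩)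
  obtain ⟨g, hg, h, hh, hgh⟩ := Submodule.mem_sup.1
    (hle ▸ Submodule.mem_top : Pi.single v (1 : ℝ) ∈ G.constOn ℝ X ⊔ G.constOn ℝ Y)
  have hval : ∀ a, g a + h a = (Pi.single v (1 : ℝ) : G.V → ℝ) a := fun a => congrFun hgh a
  have hoff : ∀ a, a ≠ v → g a = -h a := fun a ha => by
    have := hval a
    rw [Pi.single_eq_of_ne ha] at this
    linarith
  have hconst := eqvGen_congr (f := g) (by
    rintro _ _ ⟨e, ⟨he, hs, ht⟩, rfl, rfl⟩
    rcases (hmem e).1 he with he | he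
    · exact hg e he
    · rw [hoff _ hs, hoff _ ht, hh e he]) (hconn.2 u ⟨hu, huv⟩ w ⟨hw, hwv⟩)
  have hv := hval v
  rw [Pi.single_eq_same, ← hgu g hg, ← hgw h hh, hconst, hoff w hwv] at hv
  linarith

/-- A connected set of edges cannot be cut along a vertex. -/
theorem rankConn_no_cut {F : Finset G.E} (hF : RankConn G.rank F) (C : Set G.V) (v : G.V)
    (hC : ∀ e ∈ F, G.src e ∈ C ∨ G.tgt e ∈ C →
      (G.src e ∈ C ∨ G.src e = v) ∧ (G.tgt e ∈ C ∨ G.tgt e = v))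
    {e₁ e₂ : G.E} (h₁ : e₁ ∈ F) (h₁C : G.src e₁ ∈ C ∨ G.tgt e₁ ∈ C)
    (h₂ : e₂ ∈ F) : G.src e₂ ∈ C ∨ G.tgt e₂ ∈ C := by
  classical
  by_contra h₂C
  have hlt := hF (F.filter fun e => G.src e ∈ C ∨ G.tgt e ∈ C)
    (F.filter fun e => ¬ (G.src e ∈ C ∨ G.tgt e ∈ C))
    (Finset.disjoint_filter_filter_not _ _ _) (Finset.filter_union_filter_not_eq _ _)
    ⟨e₁, Finset.mem_filter.2 ⟨h₁, h₁C⟩⟩ ⟨e₂, Finset.mem_filter.2 ⟨h₂, h₂C⟩⟩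
  refine hlt.not_ge ?_
  nth_rewrite 3 [← Finset.filter_union_filter_not_eq (fun e => G.src e ∈ C ∨ G.tgt e ∈ C) F]
  rw [rank_add_le_iff, eq_top_iff]
  intro f _
  refine Submodule.mem_sup.2 ⟨fun a => if a ∈ C then f v else f a, ?_,
    fun a => if a ∈ C then f a - f v else 0, ?_, ?_⟩
  · intro e he
    obtain ⟨he, hCe⟩ := Finset.mem_filter.1 he
    obtain ⟨h1, h2⟩ := hC e he hCe
    have key : ∀ a, a ∈ C ∨ a = v → (if a ∈ C then f v else f a) = f v := by
      rintro a (h | rfl)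
      · rw [if_pos h]
      · exact ite_self _
    exact (key _ h1).trans (key _ h2).symm
  · intro e he
    have h := (Finset.mem_filter.1 he).2
    rw [not_or] at h
    simp only [if_neg h.1, if_neg h.2]
  · ext a
    by_cases h : a ∈ C <;> simp [h]

theorem nonseparable_edgeSubgr {F : Finset G.E} (hne : F.Nonempty) (hF : RankConn G.rank F) :
    (edgeSubgr F).Nonseparable := by
  constructor
  · obtain ⟨e, he⟩ := hne
    refine ⟨⟨_, (edgeSubgr F).src_mem e he⟩, ?_⟩
    rintro a ⟨e₁, h₁, h₁a⟩ b ⟨e₂, h₂, h₂b⟩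
    set C : Set G.V := {x | (edgeSubgr F).ReachIn a x} with hCdef
    have haC : a ∈ C := Relation.EqvGen.refl a
    have hC : ∀ e ∈ F, G.src e ∈ C ∨ G.tgt e ∈ C → G.src e ∈ C ∧ G.tgt e ∈ C := by
      intro e he h
      have hst : (edgeSubgr F).ReachIn (G.src e) (G.tgt e) :=
        Relation.EqvGen.rel _ _ ⟨e, he, rfl, rfl⟩
      rcases h with h | h
      · exact ⟨h, Relation.EqvGen.trans _ _ _ h hst⟩
      · exact ⟨Relation.EqvGen.trans _ _ _ h (Relation.EqvGen.symm _ _ hst), h⟩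
    have := hC e₂ h₂ (rankConn_no_cut hF C a
      (fun e he h => ⟨Or.inl (hC e he h).1, Or.inl (hC e he h).2⟩) h₁
      (h₁a.imp (Set.mem_of_eq_of_mem · haC) (Set.mem_of_eq_of_mem · haC)) h₂)
    rcases h₂b with rfl | rfl
    · exact this.1
    · exact this.2
  · intro v _
    rcases ((edgeSubgr F).deleteVert v).verts.eq_empty_or_nonempty with h | h
    · exact Or.inl h
    refine Or.inr ⟨h, ?_⟩
    rintro a ⟨⟨e₁, h₁, h₁a⟩, hav⟩ b ⟨⟨e₂, h₂, h₂b⟩, hbv⟩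
    set C : Set G.V := {x | x ≠ v ∧ ((edgeSubgr F).deleteVert v).ReachIn a x} with hCdef
    have haC : a ∈ C := ⟨hav, Relation.EqvGen.refl a⟩
    have hC : ∀ e ∈ F, G.src e ∈ C ∨ G.tgt e ∈ C →
        (G.src e ∈ C ∨ G.src e = v) ∧ (G.tgt e ∈ C ∨ G.tgt e = v) := by
      intro e he h
      by_cases hs : G.src e = v
      · exact ⟨Or.inr hs, Or.inl (h.resolve_left fun h' => h'.1 hs)⟩
      by_cases ht : G.tgt e = v
      · exact ⟨Or.inl (h.resolve_right fun h' => h'.1 ht), Or.inr ht⟩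
      have hst : ((edgeSubgr F).deleteVert v).ReachIn (G.src e) (G.tgt e) :=
        Relation.EqvGen.rel _ _ ⟨e, ⟨he, hs, ht⟩, rfl, rfl⟩
      rcases h with h | h
      · exact ⟨Or.inl h, Or.inl ⟨ht, Relation.EqvGen.trans _ _ _ h.2 hst⟩⟩
      · exact ⟨Or.inl ⟨hs, Relation.EqvGen.trans _ _ _ h.2 (Relation.EqvGen.symm _ _ hst)⟩,
          Or.inl h⟩
    have := hC e₂ h₂ (rankConn_no_cut hF C v hC h₁
      (h₁a.imp (Set.mem_of_eq_of_mem · haC) (Set.mem_of_eq_of_mem · haC)) h₂)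
    rcases h₂b with rfl | rfl
    · exact (this.1.resolve_right hbv).2
    · exact (this.2.resolve_right hbv).2

theorem numEdgeBlocks_eq (hG : G.Loopless) :
    G.numEdgeBlocks = {P | IsRankComp G.rank Finset.univ P}.ncard := by
  classical
  have hcomp : ∀ H : Subgr G, H.IsBlock → H.edges.Nonempty →
      IsRankComp G.rank Finset.univ H.edges.toFinset := by
    intro H hH hne
    refine ⟨⟨Finset.subset_univ _, Set.toFinset_nonempty.2 hne,
      hH.1.rankConn hG (Set.coe_toFinset _)⟩, fun Q hQ hle => ?_⟩
    have hHe := hH.1.1.eq_edgeSubgr (Set.coe_toFinset H.edges) (Set.toFinset_nonempty.2 hne)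
    have := (hH.2 (edgeSubgr Q) (nonseparable_edgeSubgr hQ.2.1 hQ.2.2) (by
      rw [hHe]
      rintro w ⟨e, he, h⟩
      exact ⟨e, hle he, h⟩) (Set.toFinset_subset.1 hle)).2
    intro e he
    rw [Set.mem_toFinset, ← this]
    exact he
  rw [numEdgeBlocks, ← Nat.card_coe_set_eq]
  refine Nat.card_congr (Equiv.ofBijective
    (fun H => ⟨H.1.edges.toFinset, hcomp H.1 H.2.1 H.2.2⟩) ⟨?_, ?_⟩)
  · rintro ⟨H, hH, hHne⟩ ⟨K, hK, hKne⟩ h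
    have h' : H.edges.toFinset = K.edges.toFinset := congrArg Subtype.val h
    have e1 := hH.1.1.eq_edgeSubgr (Set.coe_toFinset H.edges) (Set.toFinset_nonempty.2 hHne)
    have e2 := hK.1.1.eq_edgeSubgr (Set.coe_toFinset K.edges) (Set.toFinset_nonempty.2 hKne)
    exact Subtype.ext (e1.trans ((congrArg edgeSubgr h').trans e2.symm))
  · rintro ⟨P, ⟨-, hPne, hPc⟩, hPmax⟩
    refine ⟨⟨edgeSubgr P, ⟨nonseparable_edgeSubgr hPne hPc, fun K hK _ hPK => ?_⟩, hPne⟩,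
      Subtype.ext (Finset.ext fun e => Set.mem_toFinset)⟩
    have hPK' : P ⊆ K.edges.toFinset := fun e he => Set.mem_toFinset.2 (hPK he)
    have hKP : K.edges.toFinset ⊆ P := hPmax ⟨Finset.subset_univ _, hPne.mono hPK',
      hK.rankConn hG (Set.coe_toFinset _)⟩ hPK'
    have : K = edgeSubgr P := hK.1.eq_edgeSubgr (by
      rw [hPK'.antisymm hKP, Set.coe_toFinset]) hPne
    exact ⟨by rw [this], by rw [this]⟩

end blocks

end Multigraph

/-- For a loopless graph with `n` vertices, `c` components and `b` blocks that are
not isolated vertices, `P(G,t)` is non-zero with sign `(-1)^(n+c+b)` on `(1, 32/27]`. -/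
theorem chromatic_nonzero_one_to_32_27 (G : Multigraph) (hG : G.Loopless)
    (P : Polynomial ℝ) (hP : G.IsChromaticPoly P)
    (t : ℝ) (ht1 : 1 < t) (ht2 : t ≤ 32 / 27) :
    0 < (-1 : ℝ) ^ (Fintype.card G.V + G.numComponents + G.numEdgeBlocks) * P.eval t := by
  obtain ⟨a, ⟨ha, ha3⟩, rfl⟩ : ∃ a ∈ Set.Ioc (0 : ℝ) (1 / 3), 1 + a - a ^ 2 - a ^ 3 = t := by
    have hcont : ContinuousOn (fun a : ℝ => 1 + a - a ^ 2 - a ^ 3) (Set.Icc 0 (1 / 3)) := by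
      fun_prop
    exact intermediate_value_Ioc (by norm_num) hcont ⟨by norm_num; exact ht1, by norm_num; exact ht2⟩
  have hpos := G.isRank_rank.tutte_neg_one_sign ha ha3 Finset.univ
    fun e _ => G.rank_singleton (hG e)
  rw [hP.eval_eq_tutte (by positivity), Multigraph.numEdgeBlocks_eq hG]
  have hparity : (-1 : ℝ) ^ (Fintype.card G.V + G.numComponents +
      {P | ChromaticSign.IsRankComp G.rank Finset.univ P}.ncard) =
      (-1 : ℝ) ^ (G.rank Finset.univ +
        {P | ChromaticSign.IsRankComp G.rank Finset.univ P}.ncard) := by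
    rw [← zpow_natCast, Multigraph.rank, ← Multigraph.numComponents]
    push_cast
    rw [show (Fintype.card G.V + G.numComponents +
      {P | ChromaticSign.IsRankComp G.rank Finset.univ P}.ncard : ℤ) =
      (Fintype.card G.V - G.numComponents +
      {P | ChromaticSign.IsRankComp G.rank Finset.univ P}.ncard) + 2 * G.numComponents by ring,
      zpow_add₀ (by norm_num), zpow_mul]
    norm_num
  rw [hparity]
  refine (mul_pos (pow_pos (zero_lt_one.trans ht1) (Fintype.card G.V)) hpos).trans_eq ?_
  ring
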